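/- arXiv:math/0110314 — 2 statements merged into one kernel-verified Lean document; each statement's English description precedes it below -/
import Mathlib

section
/- Let n, p, q be natural numbers with n ≤ p, n ≤ q, and set m = p + q − n. If a strictly increasing tuple 0 ≤ i_0 < i_1 < ⋯ < i_n ≤ m satisfies onesPlus(i) = q − n and onesMinus(i) = p − n, then for every k with 0 ≤ k ≤ n one has i_k ≥ S(k) (as integers), where S(k) = Σ_{t=k+1}^{n} (−1)^{t−k−1} i_t + (−1)^{k+n}(λ(n) − ⌊n/2⌋) + ⌊k/2⌋. -/
/-- The value `i_t` of an index tuple `0 ≤ i_0 < i_1 < ⋯ < i_n ≤ m`, regarded as a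
strictly monotone function `Fin (n+1) → Fin (m+1)`, extended by `0` outside range. -/
def ival (n m : ℕ) (i : Fin (n + 1) → Fin (m + 1)) (t : ℕ) : ℕ :=
  if h : t ≤ n then (i ⟨t, Nat.lt_succ_of_le h⟩ : ℕ) else 0

/-- Block lengths of the word `(i_0,…,i_n)_m`: `b_0 = i_0`,
`b_j = i_j − i_{j−1} − 1` for `1 ≤ j ≤ n`, and `b_{n+1} = m − i_n`. -/
def blockLen (n m : ℕ) (i : Fin (n + 1) → Fin (m + 1)) (j : ℕ) : ℕ :=
  if j = 0 then ival n m i 0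
  else if j ≤ n then ival n m i j - ival n m i (j - 1) - 1
  else m - ival n m i n

/-- The number of letters `1` in the word `(i_0,…,i_n)_m^+`: the sum of the
block lengths `b_j` over odd `j` with `0 ≤ j ≤ n+1`. -/
def onesPlus (n m : ℕ) (i : Fin (n + 1) → Fin (m + 1)) : ℕ :=
  ∑ j ∈ Finset.range (n + 2), if Odd j then blockLen n m i j else 0

/-- The number of letters `1` in the word `(i_0,…,i_n)_m^-`: the sum of the
block lengths `b_j` over even `j` with `0 ≤ j ≤ n+1`. -/
def onesMinus (n m : ℕ) (i : Fin (n + 1) → Fin (m + 1)) : ℕ :=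
  ∑ j ∈ Finset.range (n + 2), if Even j then blockLen n m i j else 0

/-- The lower bound `S(k) = Σ_{t=k+1}^{n} (−1)^{t−k−1} i_t + (−1)^{k+n}(λ(n) − ⌊n/2⌋) + ⌊k/2⌋`,
where `λ(n) = p` if `n` is even and `λ(n) = q` if `n` is odd. -/
def cupS (n p q m : ℕ) (i : Fin (n + 1) → Fin (m + 1)) (k : ℕ) : ℤ :=
  (∑ t ∈ Finset.Icc (k + 1) n, (-1 : ℤ) ^ (t - k - 1) * (ival n m i t : ℤ))
    + (-1 : ℤ) ^ (k + n) * ((if Even n then (p : ℤ) else (q : ℤ)) - ((n / 2 : ℕ) : ℤ))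
    + ((k / 2 : ℕ) : ℤ)

theorem ival_lt_ival_succ {n m : ℕ} {i : Fin (n + 1) → Fin (m + 1)} (hi : StrictMono i)
    {t : ℕ} (ht : t + 1 ≤ n) : ival n m i t < ival n m i (t + 1) := by
  have ht' : t ≤ n := by omega
  simp only [ival, dif_pos ht, dif_pos ht']
  exact hi (Fin.mk_lt_mk.2 t.lt_succ_self)

theorem cast_blockLen_succ {n m : ℕ} {i : Fin (n + 1) → Fin (m + 1)} (hi : StrictMono i)
    {t : ℕ} (ht : t + 1 ≤ n) :
    (blockLen n m i (t + 1) : ℤ) = ival n m i (t + 1) - ival n m i t - 1 := by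
  have h := ival_lt_ival_succ hi ht
  simp only [blockLen, Nat.succ_ne_zero, if_false, if_pos ht, Nat.add_sub_cancel]
  omega

theorem sum_even_blockLen {n m : ℕ} {i : Fin (n + 1) → Fin (m + 1)} (hi : StrictMono i)
    (r : ℕ) (hr : 2 * r ≤ n) :
    ((∑ j ∈ Finset.range (2 * r + 1), if Even j then blockLen n m i j else 0 : ℕ) : ℤ)
      = ∑ t ∈ Finset.range (2 * r + 1), (-1 : ℤ) ^ t * ival n m i t - r := by
  induction r with
  | zero => simp [blockLen]
  | succ r ih =>
    have hb := cast_blockLen_succ hi (t := 2 * r + 1) (by omega)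
    have ih := ih (by omega)
    rw [show 2 * (r + 1) + 1 = 2 * r + 1 + 1 + 1 by ring, Finset.sum_range_succ,
      Finset.sum_range_succ, Finset.sum_range_succ _ (2 * r + 1 + 1),
      Finset.sum_range_succ _ (2 * r + 1), if_neg (by grind), if_pos (by grind)]
    push_cast at ih hb ⊢
    rw [ih, hb]
    simp only [pow_succ, pow_mul]
    norm_num
    ring

theorem sum_odd_blockLen {n m : ℕ} {i : Fin (n + 1) → Fin (m + 1)} (hi : StrictMono i)
    (r : ℕ) (hr : 2 * r ≤ n + 1) :
    ((∑ j ∈ Finset.range (2 * r), if Odd j then blockLen n m i j else 0 : ℕ) : ℤ)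
      = -∑ t ∈ Finset.range (2 * r), (-1 : ℤ) ^ t * ival n m i t - r := by
  induction r with
  | zero => simp
  | succ r ih =>
    have hb := cast_blockLen_succ hi (t := 2 * r) (by omega)
    have ih := ih (by omega)
    rw [show 2 * (r + 1) = 2 * r + 1 + 1 by ring, Finset.sum_range_succ,
      Finset.sum_range_succ, Finset.sum_range_succ _ (2 * r + 1),
      Finset.sum_range_succ _ (2 * r), if_neg (by grind), if_pos (by grind)]
    push_cast at ih hb ⊢
    rw [ih, hb]
    simp only [pow_succ, pow_mul]
    norm_num
    ring

theorem alternating_sum_ival {n p q m : ℕ} (hnp : n ≤ p) (hnq : n ≤ q)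
    {i : Fin (n + 1) → Fin (m + 1)} (hi : StrictMono i)
    (h1 : onesPlus n m i = q - n) (h2 : onesMinus n m i = p - n) :
    ∑ t ∈ Finset.range (n + 1), (-1 : ℤ) ^ t * ival n m i t
      = (-1) ^ n * ((if Even n then (p : ℤ) else (q : ℤ)) - ((n / 2 : ℕ) : ℤ)) := by
  obtain ⟨r, hr⟩ | ⟨r, hr⟩ := n.even_or_odd
  · have hs := sum_even_blockLen hi r (by omega)
    rw [onesMinus, Finset.sum_range_succ, if_neg (by grind)] at h2
    rw [show 2 * r = n by omega] at hs
    have he : Even n := ⟨r, hr⟩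
    rw [if_pos he, he.neg_one_pow]
    omega
  · have hs := sum_odd_blockLen hi (r + 1) (by omega)
    rw [onesPlus, Finset.sum_range_succ, if_neg (by grind)] at h1
    rw [show 2 * (r + 1) = n + 1 by omega] at hs
    have ho : Odd n := ⟨r, hr⟩
    rw [if_neg (Nat.not_even_iff_odd.2 ho), ho.neg_one_pow]
    omega

theorem half_le_alternating_sum_ival {n m : ℕ} {i : Fin (n + 1) → Fin (m + 1)}
    (hi : StrictMono i) : ∀ k ≤ n + 1, ((k / 2 : ℕ) : ℤ)
      ≤ (-1) ^ (k + 1) * ∑ t ∈ Finset.range k, (-1 : ℤ) ^ t * ival n m i t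
  | 0, _ => by simp
  | 1, _ => by simp
  | k + 2, hk => by
    have ih := half_le_alternating_sum_ival hi k (by omega)
    have hlt := ival_lt_ival_succ hi (t := k) (by omega)
    rw [Finset.sum_range_succ, Finset.sum_range_succ]
    obtain he | ho := k.even_or_odd
    · simp only [pow_succ, he.neg_one_pow] at ih ⊢
      omega
    · simp only [pow_succ, ho.neg_one_pow] at ih ⊢
      omega

/-- If a strictly increasing tuple `0 ≤ i_0 < ⋯ < i_n ≤ m` (with `m = p + q − n`,
`n ≤ p`, `n ≤ q`) satisfies `onesPlus(i) = q − n` and `onesMinus(i) = p − n`,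
then `i_k ≥ S(k)` (as integers) for every `0 ≤ k ≤ n`. -/
theorem ival_ge_cupS (n p q m : ℕ) (hnp : n ≤ p) (hnq : n ≤ q)
    (hm : m = p + q - n) (i : Fin (n + 1) → Fin (m + 1)) (hi : StrictMono i)
    (h1 : onesPlus n m i = q - n) (h2 : onesMinus n m i = p - n) :
    ∀ k ≤ n, cupS n p q m i k ≤ (ival n m i k : ℤ) := by
  intro k hk
  have htotal := alternating_sum_ival hnp hnq hi h1 h2
  have hhalf := half_le_alternating_sum_ival hi k (by omega)
  have htail : ∑ t ∈ Finset.Ico (k + 1) (n + 1), (-1 : ℤ) ^ t * ival n m i t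
      = (-1) ^ (k + 1) *
        ∑ t ∈ Finset.Icc (k + 1) n, (-1 : ℤ) ^ (t - k - 1) * (ival n m i t : ℤ) := by
    rw [Finset.mul_sum]
    refine Finset.sum_congr (by ext; simp) fun t ht => ?_
    rw [← mul_assoc, ← pow_add]
    congr 2
    simp at ht
    omega
  rw [← Finset.sum_range_add_sum_Ico _ (by omega : k + 1 ≤ n + 1), htail,
    Finset.sum_range_succ] at htotal
  rw [cupS, pow_add (-1 : ℤ) k n, mul_assoc, ← htotal]
  obtain he | ho := k.even_or_odd
  · simp only [pow_succ, he.neg_one_pow] at hhalf ⊢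
    linarith
  · simp only [pow_succ, ho.neg_one_pow] at hhalf ⊢
    linarith
end

section
/- Let n be an even natural number and p, q natural numbers with n ≤ p, n ≤ q; set m = p + q − n. The map i ↦ (w⁺(i), w⁻(i)) is a bijection from the set of strictly increasing tuples 0 ≤ i_0 < ⋯ < i_n ≤ m with onesPlus(i) = q − n onto the set of pairs (u, v) of Boolean words such that u contains exactly n/2 letters 0 and exactly q − n letters 1, and v contains exactly n/2 + 1 letters 0 and exactly p − n letters 1 and its last letter is 0. -/
/-- The `j`-th block of the word `(i_0,…,i_n)_m`, as a Boolean word (letter `1`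
is `true`, letter `0` is `false`): for `0 ≤ j ≤ n` it consists of `b_j` letters
`1` followed by a single letter `0`; the `(n+1)`-block consists of `b_{n+1}`
letters `1`. -/
def blockWord (n m : ℕ) (i : Fin (n + 1) → Fin (m + 1)) (j : ℕ) : List Bool :=
  if j ≤ n then List.replicate (blockLen n m i j) true ++ [false]
  else List.replicate (blockLen n m i j) true

/-- The plus word `(i_0,…,i_n)_m^+`: the concatenation, in increasing order of `j`,
of the blocks `B_j` with `j` odd, `0 ≤ j ≤ n+1` (so including the final block
`B_{n+1}` exactly when `n` is even). -/
def wPlus (n m : ℕ) (i : Fin (n + 1) → Fin (m + 1)) : List Bool :=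
  ((List.range (n + 2)).filter fun j => j % 2 = 1).flatMap (blockWord n m i)

/-- The minus word `(i_0,…,i_n)_m^-`: the concatenation, in increasing order of `j`,
of the blocks `B_j` with `j` even, `0 ≤ j ≤ n+1` (so including the final block
`B_{n+1}` exactly when `n` is odd). -/
def wMinus (n m : ℕ) (i : Fin (n + 1) → Fin (m + 1)) : List Bool :=
  ((List.range (n + 2)).filter fun j => j % 2 = 0).flatMap (blockWord n m i)

/-- The word `1^{a_0} 0 1^{a_1} 0 ⋯ 1^{a_{k-1}} 0` with run lengths `a_0, …, a_{k-1}`. -/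
def runWord (k : ℕ) (a : ℕ → ℕ) : List Bool :=
  (List.range k).flatMap fun t => List.replicate (a t) true ++ [false]

theorem runWord_zero (a : ℕ → ℕ) : runWord 0 a = [] := rfl

theorem runWord_succ (k : ℕ) (a : ℕ → ℕ) :
    runWord (k + 1) a = runWord k a ++ (List.replicate (a k) true ++ [false]) := by
  simp [runWord, List.range_succ]

theorem runWord_succ' (k : ℕ) (a : ℕ → ℕ) :
    runWord (k + 1) a =
      List.replicate (a 0) true ++ false :: runWord k (fun t => a (t + 1)) := by
  simp [runWord, List.range_succ_eq_map, List.flatMap_map]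

theorem runWord_congr {k : ℕ} {a a' : ℕ → ℕ} (h : ∀ t < k, a t = a' t) :
    runWord k a = runWord k a' :=
  List.flatMap_congr fun t ht => by rw [h t (List.mem_range.1 ht)]

theorem count_false_runWord (k : ℕ) (a : ℕ → ℕ) : (runWord k a).count false = k := by
  induction k with
  | zero => rfl
  | succ k ih => simp [runWord_succ, ih, List.count_replicate]

theorem count_true_runWord (k : ℕ) (a : ℕ → ℕ) :
    (runWord k a).count true = ∑ t ∈ Finset.range k, a t := by
  induction k with
  | zero => rfl
  | succ k ih => simp [runWord_succ, ih, Finset.sum_range_succ]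

theorem replicate_true_append_false_inj {x y : ℕ} {l l' : List Bool}
    (h : List.replicate x true ++ false :: l = List.replicate y true ++ false :: l') :
    x = y ∧ l = l' := by
  induction x generalizing y with
  | zero => cases y <;> simp_all [List.replicate_succ]
  | succ x ih =>
    cases y with
    | zero => simp [List.replicate_succ] at h
    | succ y =>
      simp only [List.replicate_succ, List.cons_append, List.cons.injEq, true_and] at h
      have := ih h
      simpa using this

theorem runWord_inj {k : ℕ} {a a' : ℕ → ℕ} (h : runWord k a = runWord k a') :
    ∀ t < k, a t = a' t := by
  induction k generalizing a a' with
  | zero => simp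
  | succ k ih =>
    rw [runWord_succ', runWord_succ'] at h
    obtain ⟨h0, h1⟩ := replicate_true_append_false_inj h
    rintro (_ | t) ht
    · exact h0
    · exact ih h1 t (by omega)

theorem exists_runWord_eq (w : List Bool) (hw : w = [] ∨ w.getLast? = some false) :
    ∃ a, runWord (w.count false) a = w := by
  induction w with
  | nil => exact ⟨fun _ => 0, rfl⟩
  | cons c w ih =>
    have hw' : w = [] ∨ w.getLast? = some false := by
      cases w with
      | nil => simp
      | cons d w => simpa using hw
    obtain ⟨a, ha⟩ := ih hw'
    cases c with
    | false =>
      refine ⟨fun t => Nat.casesOn t 0 a, ?_⟩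
      rw [List.count_cons_self, runWord_succ']
      simp [ha]
    | true =>
      have hne : w ≠ [] := by rintro rfl; simp at hw
      obtain ⟨k, hk⟩ : ∃ k, w.count false = k + 1 := by
        refine Nat.exists_eq_succ_of_ne_zero fun h0 => hne ?_
        rw [h0, runWord_zero] at ha
        exact ha.symm
      refine ⟨fun t => Nat.casesOn t (a 0 + 1) fun s => a (s + 1), ?_⟩
      rw [hk, runWord_succ'] at ha
      rw [List.count_cons_of_ne (by simp), hk, runWord_succ']
      simpa [List.replicate_succ] using ha

theorem filter_odd_range (k : ℕ) :
    ((List.range (2 * k)).filter fun j => j % 2 = 1) =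
      (List.range k).map fun t => 2 * t + 1 := by
  induction k with
  | zero => rfl
  | succ k ih =>
    rw [show 2 * (k + 1) = 2 * k + 1 + 1 by ring, List.range_succ, List.range_succ,
      List.range_succ (n := k), List.filter_append, List.filter_append, ih]
    simp [Nat.add_mod]

theorem filter_even_range (k : ℕ) :
    ((List.range (2 * k)).filter fun j => j % 2 = 0) =
      (List.range k).map fun t => 2 * t := by
  induction k with
  | zero => rfl
  | succ k ih =>
    rw [show 2 * (k + 1) = 2 * k + 1 + 1 by ring, List.range_succ, List.range_succ,
      List.range_succ (n := k), List.filter_append, List.filter_append, ih]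
    simp [Nat.add_mod]

theorem sum_odd_range (k : ℕ) (f : ℕ → ℕ) :
    (∑ j ∈ Finset.range (2 * k), if Odd j then f j else 0) =
      ∑ t ∈ Finset.range k, f (2 * t + 1) := by
  induction k with
  | zero => rfl
  | succ k ih =>
    rw [show 2 * (k + 1) = 2 * k + 1 + 1 by ring]
    simp [Finset.sum_range_succ, ih]

theorem sum_range_two_mul (k : ℕ) (f : ℕ → ℕ) :
    ∑ j ∈ Finset.range (2 * k), f j =
      ∑ t ∈ Finset.range k, f (2 * t) + ∑ t ∈ Finset.range k, f (2 * t + 1) := by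
  induction k with
  | zero => rfl
  | succ k ih =>
    rw [show 2 * (k + 1) = 2 * k + 1 + 1 by ring]
    simp only [Finset.sum_range_succ, ih]
    omega

theorem wPlus_append_false (k m : ℕ) (i : Fin (2 * k + 1) → Fin (m + 1)) :
    wPlus (2 * k) m i ++ [false] =
      runWord (k + 1) fun t => blockLen (2 * k) m i (2 * t + 1) := by
  rw [runWord_succ, wPlus, show 2 * k + 2 = 2 * (k + 1) by ring, filter_odd_range,
    List.range_succ, List.map_append, List.flatMap_append, List.flatMap_map, runWord,
    List.append_assoc]
  congr 1
  · refine List.flatMap_congr fun t ht => ?_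
    have := List.mem_range.1 ht
    rw [blockWord, if_pos (by omega)]
  · simp [blockWord]

theorem wMinus_eq_runWord (k m : ℕ) (i : Fin (2 * k + 1) → Fin (m + 1)) :
    wMinus (2 * k) m i = runWord (k + 1) fun t => blockLen (2 * k) m i (2 * t) := by
  rw [wMinus, show 2 * k + 2 = 2 * (k + 1) by ring, filter_even_range, List.flatMap_map,
    runWord]
  refine List.flatMap_congr fun t ht => ?_
  have := List.mem_range.1 ht
  rw [blockWord, if_pos (by omega)]

theorem onesPlus_two_mul (k m : ℕ) (i : Fin (2 * k + 1) → Fin (m + 1)) :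
    onesPlus (2 * k) m i =
      ∑ t ∈ Finset.range (k + 1), blockLen (2 * k) m i (2 * t + 1) := by
  rw [onesPlus, show 2 * k + 2 = 2 * (k + 1) by ring, sum_odd_range]

theorem ival_eq_add_sum_blockLen {n m : ℕ} {i : Fin (n + 1) → Fin (m + 1)}
    (hi : StrictMono i) {t : ℕ} (ht : t ≤ n) :
    ival n m i t = t + ∑ j ∈ Finset.range (t + 1), blockLen n m i j := by
  induction t with
  | zero => simp [blockLen]
  | succ t ih =>
    have h := ih (by omega)
    have hlt : ival n m i t < ival n m i (t + 1) := by
      rw [ival, ival, dif_pos (by omega), dif_pos ht]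
      exact hi (Fin.mk_lt_mk.2 (Nat.lt_succ_self t))
    have hb : blockLen n m i (t + 1) = ival n m i (t + 1) - ival n m i t - 1 := by
      simp [blockLen, ht]
    rw [Finset.sum_range_succ, hb]
    omega

theorem add_sum_blockLen {n m : ℕ} {i : Fin (n + 1) → Fin (m + 1)} (hi : StrictMono i) :
    n + ∑ j ∈ Finset.range (n + 2), blockLen n m i j = m := by
  have h := ival_eq_add_sum_blockLen hi le_rfl
  have hle : ival n m i n ≤ m := by
    rw [ival, dif_pos le_rfl]
    exact Nat.lt_succ_iff.1 (i _).isLt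
  have hb : blockLen n m i (n + 1) = m - ival n m i n := by simp [blockLen]
  rw [Finset.sum_range_succ, hb]
  omega

theorem eq_of_blockLen_eq {n m : ℕ} {i i' : Fin (n + 1) → Fin (m + 1)}
    (hi : StrictMono i) (hi' : StrictMono i')
    (h : ∀ j ≤ n, blockLen n m i j = blockLen n m i' j) : i = i' := by
  funext t
  have ht : (t : ℕ) ≤ n := Nat.lt_succ_iff.1 t.isLt
  have hv : ival n m i t = ival n m i' t := by
    rw [ival_eq_add_sum_blockLen hi ht, ival_eq_add_sum_blockLen hi' ht]
    congr 1
    refine Finset.sum_congr rfl fun j hj => h j ?_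
    have := Finset.mem_range.1 hj
    omega
  rw [ival, ival, dif_pos ht, dif_pos ht] at hv
  exact Fin.ext hv

theorem exists_strictMono_blockLen_eq {n m : ℕ} (b : ℕ → ℕ)
    (hb : n + ∑ j ∈ Finset.range (n + 2), b j = m) :
    ∃ i : Fin (n + 1) → Fin (m + 1), StrictMono i ∧
      ∀ j < n + 2, blockLen n m i j = b j := by
  have hlt : ∀ t : Fin (n + 1), (t : ℕ) + ∑ j ∈ Finset.range (t + 1), b j < m + 1 := by
    intro t
    have : ∑ j ∈ Finset.range (t + 1), b j ≤ ∑ j ∈ Finset.range (n + 2), b j :=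
      Finset.sum_le_sum_of_subset (Finset.range_mono (by omega))
    omega
  let i : Fin (n + 1) → Fin (m + 1) := fun t => ⟨_, hlt t⟩
  have hval : ∀ t ≤ n, ival n m i t = t + ∑ j ∈ Finset.range (t + 1), b j := by
    intro t ht
    rw [ival, dif_pos ht]
  refine ⟨i, fun s t hst => ?_, fun j hj => ?_⟩
  · have : ∑ j ∈ Finset.range (s + 1), b j ≤ ∑ j ∈ Finset.range (t + 1), b j :=
      Finset.sum_le_sum_of_subset (Finset.range_mono (by omega))
    refine Fin.mk_lt_mk.2 ?_
    have : (s : ℕ) < t := hst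
    omega
  · rcases j with _ | j
    · simp [blockLen, hval]
    · by_cases hjn : j + 1 ≤ n
      · have h1 := hval (j + 1) hjn
        have h0 := hval j (by omega)
        rw [Finset.sum_range_succ] at h1
        simp only [blockLen, Nat.add_eq_zero_iff, one_ne_zero, and_false, if_false,
          if_pos hjn, Nat.add_sub_cancel]
        omega
      · obtain rfl : j = n := by omega
        have h0 := hval j le_rfl
        rw [Finset.sum_range_succ] at hb
        simp only [blockLen, Nat.add_eq_zero_iff, one_ne_zero, and_false, if_false,
          if_neg hjn]
        omega

/-- For `n` even, `n ≤ p`, `n ≤ q`, `m = p + q − n`, the map `i ↦ (w⁺(i), w⁻(i))`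
is a bijection from the set of strictly increasing tuples `0 ≤ i_0 < ⋯ < i_n ≤ m`
with `onesPlus(i) = q − n` onto the set of pairs `(u, v)` of Boolean words such
that `u` has exactly `n/2` letters `0` and `q − n` letters `1`, and `v` has
exactly `n/2 + 1` letters `0`, `p − n` letters `1`, and its last letter is `0`. -/
theorem word_pair_bijOn_even (n p q m : ℕ) (hn : Even n) (hnp : n ≤ p)
    (hnq : n ≤ q) (hm : m = p + q - n) :
    Set.BijOn (fun i : Fin (n + 1) → Fin (m + 1) => (wPlus n m i, wMinus n m i))
      {i | StrictMono i ∧ onesPlus n m i = q - n}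
      {uv : List Bool × List Bool |
        uv.1.count false = n / 2 ∧ uv.1.count true = q - n ∧
        uv.2.count false = n / 2 + 1 ∧ uv.2.count true = p - n ∧
        uv.2.getLast? = some false} := by
  obtain ⟨k, rfl⟩ := hn.exists_two_nsmul
  simp only [smul_eq_mul] at *
  rw [Nat.mul_div_cancel_left k two_pos]
  refine ⟨?_, ?_, ?_⟩
  · rintro i ⟨hi, hones⟩
    have hsum := add_sum_blockLen hi
    rw [show 2 * k + 2 = 2 * (k + 1) by ring, sum_range_two_mul, ← onesPlus_two_mul,
      hones] at hsum
    have hf := congrArg (List.count false) (wPlus_append_false k m i)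
    have ht := congrArg (List.count true) (wPlus_append_false k m i)
    rw [count_false_runWord, List.count_append] at hf
    rw [count_true_runWord, List.count_append, ← onesPlus_two_mul, hones] at ht
    refine ⟨by simpa using hf, by simpa using ht, ?_, ?_, ?_⟩
    · simp only [wMinus_eq_runWord, count_false_runWord]
    · simp only [wMinus_eq_runWord, count_true_runWord]
      omega
    · simp [wMinus_eq_runWord, runWord_succ]
  · rintro i ⟨hi, -⟩ i' ⟨hi', -⟩ h
    obtain ⟨hplus, hminus⟩ := Prod.mk.inj h
    rw [wMinus_eq_runWord, wMinus_eq_runWord] at hminus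
    have hplus' := congrArg (· ++ [false]) hplus
    simp only [wPlus_append_false] at hplus'
    refine eq_of_blockLen_eq hi hi' fun j hj => ?_
    obtain ⟨t, rfl | rfl⟩ := j.even_or_odd'
    · exact runWord_inj hminus t (by omega)
    · exact runWord_inj hplus' t (by omega)
  · rintro ⟨u, v⟩ ⟨huf, hut, hvf, hvt, hvl⟩
    dsimp only at huf hut hvf hvt hvl
    obtain ⟨a, ha⟩ := exists_runWord_eq (u ++ [false]) (Or.inr (by simp))
    obtain ⟨c, hc⟩ := exists_runWord_eq v (Or.inr hvl)
    rw [hvf] at hc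
    rw [List.count_append, huf, List.count_singleton_self] at ha
    have hasum := congrArg (List.count true) ha
    have hcsum := congrArg (List.count true) hc
    rw [count_true_runWord, List.count_append, hut] at hasum
    rw [count_true_runWord, hvt] at hcsum
    rw [List.count_eq_zero_of_not_mem (by simp), add_zero] at hasum
    let b : ℕ → ℕ := fun j => if j % 2 = 0 then c (j / 2) else a (j / 2)
    have hbe : ∀ t, b (2 * t) = c t := fun t => by simp [b]
    have hbo : ∀ t, b (2 * t + 1) = a t := fun t => by
      simp [b, Nat.add_mod, show (2 * t + 1) / 2 = t by omega]
    obtain ⟨i, hi, hbi⟩ := exists_strictMono_blockLen_eq (n := 2 * k) (m := m) b (by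
      rw [show 2 * k + 2 = 2 * (k + 1) by ring, sum_range_two_mul]
      simp only [hbe, hbo, hasum, hcsum]
      omega)
    have hodd : ∀ t ∈ Finset.range (k + 1), blockLen (2 * k) m i (2 * t + 1) = a t := by
      intro t ht
      have := Finset.mem_range.1 ht
      rw [hbi _ (by omega), hbo]
    have heven : ∀ t ∈ Finset.range (k + 1), blockLen (2 * k) m i (2 * t) = c t := by
      intro t ht
      have := Finset.mem_range.1 ht
      rw [hbi _ (by omega), hbe]
    refine ⟨i, ⟨hi, ?_⟩, Prod.ext ?_ ?_⟩
    · rw [onesPlus_two_mul, Finset.sum_congr rfl hodd, hasum]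
    · refine List.append_cancel_right (bs := [false]) ?_
      dsimp only
      rw [wPlus_append_false, ← ha]
      exact runWord_congr fun t ht => hodd t (Finset.mem_range.2 ht)
    · dsimp only
      rw [wMinus_eq_runWord, ← hc]
      exact runWord_congr fun t ht => heven t (Finset.mem_range.2 ht)
end
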